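/- Highest elements for A_{2n−1}^(2): Let n ≥ 2, l ≥ k ≥ 1, let ι : B_l ⊗ B_k → B_k ⊗ B_l be any isomorphism of U_q'(A_{2n−1}^(2)) crystals and H any energy function for ι. Let x_1, x_2, x̄_1 be nonnegative integers with x_1 + x_2 + x̄_1 = k. Then ι((l,0,…,0) ⊗ (x_1,x_2,---,x̄_1)) = (k,0,…,0) ⊗ (l−x_2−x̄_1, x_2, ---, x̄_1), and H((l,0,…,0) ⊗ (x_1,x_2,---,x̄_1)) = 2k − x_2 − 2x̄_1. -/

import Mathlib

namespace KTT

/-- Raw data of a crystal element `(x_1,…,x_n,x̄_n,…,x̄_1)`: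
`b.1 i` is `x_{i+1}` and `b.2 i` is `x̄_{i+1}` for `i : Fin n`. -/
abbrev Tup (n : ℕ) := (Fin n → ℕ) × (Fin n → ℕ)

/-- The entry `x_j` (for `1 ≤ j ≤ n`). -/
def xc {n : ℕ} (b : Tup n) (j : ℕ) : ℕ :=
  if h : j - 1 < n then b.1 ⟨j - 1, h⟩ else 0

/-- The entry `x̄_j` (for `1 ≤ j ≤ n`). -/
def xbc {n : ℕ} (b : Tup n) (j : ℕ) : ℕ :=
  if h : j - 1 < n then b.2 ⟨j - 1, h⟩ else 0

/-- Set the entry indexed by `j` (i.e. `x_j`) to the value `v`. -/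
def setx {n : ℕ} (f : Fin n → ℕ) (j v : ℕ) : Fin n → ℕ :=
  fun t => if (t : ℕ) + 1 = j then v else f t

/-- `Σ_{i=1}^n (x_i + x̄_i)`. -/
def tsum {n : ℕ} (b : Tup n) : ℕ := ∑ i, (b.1 i + b.2 i)

/-- The element `(v,0,…,0)`. -/
def uvec (n v : ℕ) : Tup n := (fun j => if (j : ℕ) = 0 then v else 0, fun _ => 0)

/-- The element `(0,v,---,0)` (only `x_2 = v` nonzero). -/
def u2vec (n v : ℕ) : Tup n := (fun j => if (j : ℕ) = 1 then v else 0, fun _ => 0)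

/-- The element `(0,0,---,v)` (only `x̄_1 = v` nonzero). -/
def barvec (n v : ℕ) : Tup n := (fun _ => 0, fun j => if (j : ℕ) = 0 then v else 0)

/-- The element `(a,c,---,d)` with `x_1 = a`, `x_2 = c`, `x̄_1 = d`, all else `0`. -/
def tripleVec (n a c d : ℕ) : Tup n :=
  (fun j => if (j : ℕ) = 0 then a else if (j : ℕ) = 1 then c else 0,
   fun j => if (j : ℕ) = 0 then d else 0)

/-! ### The `U_q'(C_n^{(1)})` crystal `B_l` -/

/-- Membership in the `C_n^{(1)}` crystal `B_l` : the sum of the entries belongs to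
`{l, l-2, l-4, …}`. -/
def memC (n l : ℕ) (b : Tup n) : Prop := tsum b ≤ l ∧ (l - tsum b) % 2 = 0

def BC (n l : ℕ) : Set (Tup n) := {b | memC n l b}

/-- The number `x_0(b)` of `(0,0̄)` pairs. -/
def x0 (l : ℕ) {n : ℕ} (b : Tup n) : ℕ := (l - tsum b) / 2

/-- The operator `ẽ_i` on `B_l` (C case); `none` plays the role of `0`. -/
def eC (n l i : ℕ) (b : Tup n) : Option (Tup n) :=
  if i = 0 then
    if 0 < n then
      if xbc b 1 + 2 ≤ xc b 1 then some (setx b.1 1 (xc b 1 - 2), b.2)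
      else if xc b 1 = xbc b 1 + 1 then
        some (setx b.1 1 (xc b 1 - 1), setx b.2 1 (xbc b 1 + 1))
      else if tsum b + 2 ≤ l then some (b.1, setx b.2 1 (xbc b 1 + 2))
      else none
    else none
  else if i = n then
    if 0 < xbc b n then some (setx b.1 n (xc b n + 1), setx b.2 n (xbc b n - 1))
    else none
  else if i < n then
    if xbc b (i + 1) < xc b (i + 1) then
      some (setx (setx b.1 i (xc b i + 1)) (i + 1) (xc b (i + 1) - 1), b.2)
    else if 0 < xbc b i then
      some (b.1, setx (setx b.2 (i + 1) (xbc b (i + 1) + 1)) i (xbc b i - 1))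
    else none
  else none

/-- The operator `f̃_i` on `B_l` (C case). -/
def fC (n l i : ℕ) (b : Tup n) : Option (Tup n) :=
  if i = 0 then
    if 0 < n then
      if xbc b 1 ≤ xc b 1 then
        if tsum b + 2 ≤ l then some (setx b.1 1 (xc b 1 + 2), b.2) else none
      else if xc b 1 + 1 = xbc b 1 then
        some (setx b.1 1 (xc b 1 + 1), setx b.2 1 (xbc b 1 - 1))
      else some (b.1, setx b.2 1 (xbc b 1 - 2))
    else none
  else if i = n then
    if 0 < xc b n then some (setx b.1 n (xc b n - 1), setx b.2 n (xbc b n + 1))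
    else none
  else if i < n then
    if xbc b (i + 1) ≤ xc b (i + 1) then
      if 0 < xc b i then
        some (setx (setx b.1 i (xc b i - 1)) (i + 1) (xc b (i + 1) + 1), b.2)
      else none
    else some (b.1, setx (setx b.2 (i + 1) (xbc b (i + 1) - 1)) i (xbc b i + 1))
  else none

def eCIter (n l i m : ℕ) (b : Tup n) : Option (Tup n) :=
  (fun o => Option.bind o (eC n l i))^[m] (some b)

def fCIter (n l i m : ℕ) (b : Tup n) : Option (Tup n) :=
  (fun o => Option.bind o (fC n l i))^[m] (some b)

/-- `ε_i(b) = max {m | ẽ_i^m b ≠ 0}` (C case). -/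
noncomputable def epsC (n l i : ℕ) (b : Tup n) : ℕ :=
  sSup {m | eCIter n l i m b ≠ none}

/-- `φ_i(b) = max {m | f̃_i^m b ≠ 0}` (C case). -/
noncomputable def phiC (n l i : ℕ) (b : Tup n) : ℕ :=
  sSup {m | fCIter n l i m b ≠ none}

/-- `ẽ_i` on the tensor product `B_l ⊗ B_k` (C case). -/
noncomputable def eTenC (n l k i : ℕ) (u : Tup n × Tup n) : Option (Tup n × Tup n) :=
  if epsC n k i u.2 ≤ phiC n l i u.1 then (eC n l i u.1).map (fun c => (c, u.2))
  else (eC n k i u.2).map (fun c => (u.1, c))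

/-- `f̃_i` on the tensor product `B_l ⊗ B_k` (C case). -/
noncomputable def fTenC (n l k i : ℕ) (u : Tup n × Tup n) : Option (Tup n × Tup n) :=
  if epsC n k i u.2 < phiC n l i u.1 then (fC n l i u.1).map (fun c => (c, u.2))
  else (fC n k i u.2).map (fun c => (u.1, c))

/-- `ι : B_l ⊗ B_k → B_k ⊗ B_l` is an isomorphism of `U_q'(C_n^{(1)})` crystals. -/
def IsIsoC (n l k : ℕ) (ι : Tup n × Tup n → Tup n × Tup n) : Prop :=
  Set.BijOn ι (BC n l ×ˢ BC n k) (BC n k ×ˢ BC n l) ∧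
  ∀ u ∈ BC n l ×ˢ BC n k, ∀ i ≤ n,
    Option.map ι (eTenC n l k i u) = eTenC n k l i (ι u) ∧
    Option.map ι (fTenC n l k i u) = fTenC n k l i (ι u)

/-- `H` is an energy function for the isomorphism `ι` (C case), normalized by
`H((l,0,…,0) ⊗ (0,k,---,0)) = 0`. -/
def IsEnergyC (n l k : ℕ) (ι : Tup n × Tup n → Tup n × Tup n)
    (H : Tup n × Tup n → ℤ) : Prop :=
  (∀ u ∈ BC n l ×ˢ BC n k, ∀ i ≤ n, ∀ v, eTenC n l k i u = some v →
      H v = H u +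
        (if i = 0 then
          (if epsC n k 0 u.2 ≤ phiC n l 0 u.1 ∧ epsC n l 0 (ι u).2 ≤ phiC n k 0 (ι u).1
           then 1
           else if phiC n l 0 u.1 < epsC n k 0 u.2 ∧ phiC n k 0 (ι u).1 < epsC n l 0 (ι u).2
           then -1 else 0)
         else 0)) ∧
  H (uvec n l, u2vec n k) = 0

/-! ### The `U_q'(A_{2n-1}^{(2)})` crystal `B_l` -/

def memA (n l : ℕ) (b : Tup n) : Prop := tsum b = l

def BA (n l : ℕ) : Set (Tup n) := {b | memA n l b}

/-- The operator `ẽ_i` (A case). -/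
def eA (n i : ℕ) (b : Tup n) : Option (Tup n) :=
  if i = 0 then
    if 1 < n then
      if xbc b 2 < xc b 2 then some (setx b.1 2 (xc b 2 - 1), setx b.2 1 (xbc b 1 + 1))
      else if 0 < xc b 1 then some (setx b.1 1 (xc b 1 - 1), setx b.2 2 (xbc b 2 + 1))
      else none
    else none
  else if i = n then
    if 0 < xbc b n then some (setx b.1 n (xc b n + 1), setx b.2 n (xbc b n - 1))
    else none
  else if i < n then
    if xbc b (i + 1) < xc b (i + 1) then
      some (setx (setx b.1 i (xc b i + 1)) (i + 1) (xc b (i + 1) - 1), b.2)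
    else if 0 < xbc b i then
      some (b.1, setx (setx b.2 (i + 1) (xbc b (i + 1) + 1)) i (xbc b i - 1))
    else none
  else none

/-- The operator `f̃_i` (A case). -/
def fA (n i : ℕ) (b : Tup n) : Option (Tup n) :=
  if i = 0 then
    if 1 < n then
      if xbc b 2 ≤ xc b 2 then
        if 0 < xbc b 1 then some (setx b.1 2 (xc b 2 + 1), setx b.2 1 (xbc b 1 - 1))
        else none
      else some (setx b.1 1 (xc b 1 + 1), setx b.2 2 (xbc b 2 - 1))
    else none
  else if i = n then
    if 0 < xc b n then some (setx b.1 n (xc b n - 1), setx b.2 n (xbc b n + 1))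
    else none
  else if i < n then
    if xbc b (i + 1) ≤ xc b (i + 1) then
      if 0 < xc b i then
        some (setx (setx b.1 i (xc b i - 1)) (i + 1) (xc b (i + 1) + 1), b.2)
      else none
    else some (b.1, setx (setx b.2 (i + 1) (xbc b (i + 1) - 1)) i (xbc b i + 1))
  else none

def eAIter (n i m : ℕ) (b : Tup n) : Option (Tup n) :=
  (fun o => Option.bind o (eA n i))^[m] (some b)

def fAIter (n i m : ℕ) (b : Tup n) : Option (Tup n) :=
  (fun o => Option.bind o (fA n i))^[m] (some b)

noncomputable def epsA (n i : ℕ) (b : Tup n) : ℕ :=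
  sSup {m | eAIter n i m b ≠ none}

noncomputable def phiA (n i : ℕ) (b : Tup n) : ℕ :=
  sSup {m | fAIter n i m b ≠ none}

/-- `ẽ_i` on a tensor product (A case). -/
noncomputable def eTenA (n i : ℕ) (u : Tup n × Tup n) : Option (Tup n × Tup n) :=
  if epsA n i u.2 ≤ phiA n i u.1 then (eA n i u.1).map (fun c => (c, u.2))
  else (eA n i u.2).map (fun c => (u.1, c))

/-- `f̃_i` on a tensor product (A case). -/
noncomputable def fTenA (n i : ℕ) (u : Tup n × Tup n) : Option (Tup n × Tup n) :=
  if epsA n i u.2 < phiA n i u.1 then (fA n i u.1).map (fun c => (c, u.2))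
  else (fA n i u.2).map (fun c => (u.1, c))

/-- `ι : B_l ⊗ B_k → B_k ⊗ B_l` is an isomorphism of `U_q'(A_{2n-1}^{(2)})` crystals. -/
def IsIsoA (n l k : ℕ) (ι : Tup n × Tup n → Tup n × Tup n) : Prop :=
  Set.BijOn ι (BA n l ×ˢ BA n k) (BA n k ×ˢ BA n l) ∧
  ∀ u ∈ BA n l ×ˢ BA n k, ∀ i ≤ n,
    Option.map ι (eTenA n i u) = eTenA n i (ι u) ∧
    Option.map ι (fTenA n i u) = fTenA n i (ι u)

/-- `H` is an energy function for `ι` (A case), normalized by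
`H((l,0,…,0) ⊗ (0,0,---,k)) = 0`. -/
def IsEnergyA (n l k : ℕ) (ι : Tup n × Tup n → Tup n × Tup n)
    (H : Tup n × Tup n → ℤ) : Prop :=
  (∀ u ∈ BA n l ×ˢ BA n k, ∀ i ≤ n, ∀ v, eTenA n i u = some v →
      H v = H u +
        (if i = 0 then
          (if epsA n 0 u.2 ≤ phiA n 0 u.1 ∧ epsA n 0 (ι u).2 ≤ phiA n 0 (ι u).1
           then 1
           else if phiA n 0 u.1 < epsA n 0 u.2 ∧ phiA n 0 (ι u).1 < epsA n 0 (ι u).2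
           then -1 else 0)
         else 0)) ∧
  H (uvec n l, barvec n k) = 0

/-! ### Words, tableaux and column insertion

Letters are encoded as natural numbers: the unbarred letter `j` (for `0 ≤ j ≤ n`) is `j`,
and the barred letter `j̄` is `2n+1-j`; the natural order of `ℕ` is the order
`0 < 1 < ⋯ < n < n̄ < ⋯ < 1̄ < 0̄`.  A (two-row) tableau is encoded as the list of its
columns (left to right), each column being the list of its entries (top to bottom). -/

/-- The barred partner `j̄` of an unbarred letter `j`. -/
def bar (n j : ℕ) : ℕ := 2 * n + 1 - j

/-- Column insertion of a letter into a tableau with at most two rows. -/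
def insertLetter (n : ℕ) : ℕ → List (List ℕ) → List (List ℕ)
  | a, [] => [[a]]
  | a, [p] :: rest =>
      if a ≤ p then [a] :: insertLetter n p rest else [p, a] :: rest
  | a, [p, q] :: rest =>
      if p ≠ 0 ∧ p ≤ n ∧ q = bar n p ∧ p ≤ a ∧ a ≤ q then
        -- the column is a pair `(x, x̄)` with `x ≠ 0` and `x ≤ a ≤ x̄`
        [p - 1, a] :: insertLetter n (bar n (p - 1)) rest
      else if n + 1 ≤ q ∧ bar n q < p ∧ p < q ∧ a = bar n q ∧ q ≠ n + 1 then
        -- the column is `(β, x̄)` with `x < β < x̄`, `a = x` and `x ≠ n`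
        [a + 1, bar n (a + 1)] :: insertLetter n p rest
      else if a ≤ p then [a, q] :: insertLetter n p rest
      else if a ≤ q then [p, a] :: insertLetter n q rest
      else [p, q, a] :: rest
  | a, C :: rest => (C ++ [a]) :: rest

/-- Column insertion of a word `u = u_1 ⋯ u_j` into a tableau: `u_j` first, `u_1` last. -/
def insertWord (n : ℕ) (u : List ℕ) (T : List (List ℕ)) : List (List ℕ) :=
  u.foldr (fun a T => insertLetter n a T) T

/-- One step of reverse insertion: letter `g` comes back (moving leftward) into a column;
returns the restored column together with the letter passed further left. -/
def revStep (n g : ℕ) (C : List ℕ) : List ℕ × ℕ :=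
  match C with
  | [p] => ([g], p)
  | [p, q] =>
      if p ≠ 0 ∧ p ≤ n ∧ q = bar n p ∧ p ≤ g ∧ g ≤ q then
        ([g, bar n (p - 1)], p - 1)
      else if p ≤ n ∧ g = bar n p ∧ p < q ∧ q < g ∧ p ≠ n then
        ([p + 1, bar n (p + 1)], q)
      else if q ≤ g then ([p, g], q)
      else ([g, q], p)
  | _ => (C, g)

/-- Reverse insertion of a letter through a list of columns, from right to left;
returns the new columns and the letter ejected from the leftmost column. -/
def revPass (n g : ℕ) : List (List ℕ) → List (List ℕ) × ℕ
  | [] => ([], g)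
  | C :: rest =>
      let p := revPass n g rest
      let q := revStep n p.2 C
      (q.1 :: p.1, q.2)

/-- Reverse-bump the rightmost cell of the first row (the last column, a single box). -/
def rbFirst (n : ℕ) (T : List (List ℕ)) : List (List ℕ) × ℕ :=
  match T.getLast? with
  | some [a] => revPass n a T.dropLast
  | _ => (T, 0)

/-- Number of columns of height (at least) two, i.e. the length of the second row. -/
def numTwoCols (T : List (List ℕ)) : ℕ :=
  (T.filter (fun C => decide (2 ≤ C.length))).length

/-- Reverse-bump the rightmost cell of the second row. -/
def rbSecond (n : ℕ) (T : List (List ℕ)) : List (List ℕ) × ℕ :=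
  match (T.drop (numTwoCols T - 1)).head? with
  | some [a, b] =>
      let p := revPass n b (T.take (numTwoCols T - 1))
      (p.1 ++ [a] :: T.drop (numTwoCols T), p.2)
  | _ => (T, 0)

/-- Iterate a reverse-bumping step, collecting the ejected letters in order of ejection. -/
def rbIter (step : List (List ℕ) → List (List ℕ) × ℕ) :
    ℕ → List (List ℕ) → List (List ℕ) × List ℕ
  | 0, T => (T, [])
  | c + 1, T =>
      let p := step T
      let q := rbIter step c p.1
      (q.1, p.2 :: q.2)

/-- A one-row word regarded as a tableau (list of one-box columns). -/
def rowCols (w : List ℕ) : List (List ℕ) := w.map (fun a => [a])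

/-- The row word of a one-row tableau. -/
def colsWord (T : List (List ℕ)) : List ℕ := T.foldr (fun C acc => C ++ acc) []

/-- The word `1^{x_1} ⋯ n^{x_n} n̄^{x̄_n} ⋯ 1̄^{x̄_1}`. -/
def coreWord (n : ℕ) (b : Tup n) : List ℕ :=
  ((List.finRange n).map (fun i => List.replicate (b.1 i) ((i : ℕ) + 1))).foldr (· ++ ·) []
  ++ ((List.finRange n).reverse.map
      (fun i => List.replicate (b.2 i) (bar n ((i : ℕ) + 1)))).foldr (· ++ ·) []

/-- The word `𝕋(b) = 0^{x_0} 1^{x_1} ⋯ 1̄^{x̄_1} 0̄^{x_0}` of an element of the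
`C_n^{(1)}` crystal `B_l`. -/
def rowWordC (n l : ℕ) (b : Tup n) : List ℕ :=
  List.replicate (x0 l b) 0 ++ coreWord n b ++ List.replicate (x0 l b) (bar n 0)

/-- The word `𝕋(b)` with `z` pairs `(0, 0̄)` removed. -/
def hatWordC (n l z : ℕ) (b : Tup n) : List ℕ :=
  List.replicate (x0 l b - z) 0 ++ coreWord n b ++ List.replicate (x0 l b - z) (bar n 0)

/-- The word `𝒯(b) = 1^{x_1} ⋯ 1̄^{x̄_1}` of an element of the `A_{2n-1}^{(2)}` crystal. -/
def rowWordA (n : ℕ) (b : Tup n) : List ℕ := coreWord n b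



section Helpers

variable {n : ℕ}

lemma iter_none {α : Type*} (g : α → Option α) (m : ℕ) :
    (fun o => Option.bind o g)^[m] none = none := by
  induction m with
  | zero => rfl
  | succ m ih => rw [Function.iterate_succ_apply]; exact ih

lemma iter_bound {α : Type*} (g : α → Option α) (μ : α → ℕ)
    (h : ∀ b b', g b = some b' → μ b' < μ b) (m : ℕ) :
    ∀ b, (fun o => Option.bind o g)^[m] (some b) ≠ none → m ≤ μ b := by
  induction m with
  | zero => intro b _; omega
  | succ m ih =>
    intro b hb
    rw [Function.iterate_succ_apply] at hb
    cases hg : g b with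
    | none =>
      exfalso; apply hb
      simp only [Option.bind_some, hg]
      exact iter_none g m
    | some b' =>
      have h1 : (fun o => Option.bind o g)^[m] (some b') ≠ none := by
        simpa only [Option.bind_some, hg] using hb
      have := ih b' h1
      have := h b b' hg
      omega

lemma sSup_iter_zero {α : Type*} (g : α → Option α) (b : α) (h : g b = none) :
    sSup {m | (fun o => Option.bind o g)^[m] (some b) ≠ none} = 0 := by
  have : {m | (fun o => Option.bind o g)^[m] (some b) ≠ none} ⊆ {0} := by
    intro m hm
    cases m with
    | zero => rfl
    | succ m =>
      exfalso; apply hm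
      rw [Function.iterate_succ_apply]
      simp only [Option.bind_some, h]
      exact iter_none g m
  rcases Set.subset_singleton_iff_eq.1 this with h | h <;> rw [h] <;> simp

lemma phi_zero (i : ℕ) (b : Tup n) (h : fA n i b = none) : phiA n i b = 0 :=
  sSup_iter_zero _ _ h

lemma eps_zero (i : ℕ) (b : Tup n) (h : eA n i b = none) : epsA n i b = 0 :=
  sSup_iter_zero _ _ h

lemma xc_setx (f g : Fin n → ℕ) (j v j' : ℕ) (h : 1 ≤ j') (h' : j' ≤ n) :
    xc (setx f j v, g) j' = if j' = j then v else xc (f, g) j' := by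
  have h1 : j' - 1 < n := by omega
  have h2 : j' - 1 + 1 = j' := by omega
  simp [xc, setx, h1, h2]

lemma xbc_setx (f g : Fin n → ℕ) (j v j' : ℕ) (h : 1 ≤ j') (h' : j' ≤ n) :
    xbc (f, setx g j v) j' = if j' = j then v else xbc (f, g) j' := by
  have h1 : j' - 1 < n := by omega
  have h2 : j' - 1 + 1 = j' := by omega
  simp [xbc, setx, h1, h2]

lemma xc_fst (f g g' : Fin n → ℕ) (j : ℕ) : xc (f, g) j = xc (f, g') j := rfl
lemma xbc_snd (f f' g : Fin n → ℕ) (j : ℕ) : xbc (f, g) j = xbc (f', g) j := rfl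

lemma eA_meas_mid (i : ℕ) (h1 : 1 ≤ i) (hi : i < n) (b b' : Tup n) (h : eA n i b = some b') :
    xc b' (i+1) + xbc b' i < xc b (i+1) + xbc b i := by
  have h0 : i ≠ 0 := by omega
  have hn : i ≠ n := by omega
  revert h
  obtain ⟨f, g⟩ := b
  intro h
  simp only [eA, h0, hn, hi, if_true, if_false] at h
  split_ifs at h with h1 h2
  · cases h
    rw [xc_setx _ _ _ _ _ (by omega) (by omega)]
    rw [xbc_snd _ f g i]
    simp
    omega
  · cases h
    rw [xbc_setx _ _ _ _ _ (by omega) (by omega)]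
    rw [xc_fst f _ g]
    simp
    omega

lemma fA_meas_mid (i : ℕ) (h1 : 1 ≤ i) (hi : i < n) (b b' : Tup n) (h : fA n i b = some b') :
    xc b' i + xbc b' (i+1) < xc b i + xbc b (i+1) := by
  have h0 : i ≠ 0 := by omega
  have hn : i ≠ n := by omega
  revert h
  obtain ⟨f, g⟩ := b
  intro h
  simp only [fA, h0, hn, hi, if_true, if_false] at h
  split_ifs at h with h1 h2
  · cases h
    rw [xc_setx _ _ _ _ _ (by omega) (by omega), xc_setx _ _ _ _ _ (by omega) (by omega)]
    rw [xbc_snd _ f g]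
    simp
    omega
  · cases h
    rw [xbc_setx _ _ _ _ _ (by omega) (by omega), xbc_setx _ _ _ _ _ (by omega) (by omega)]
    rw [xc_fst f _ g]
    simp
    omega

lemma eA_measure (i : ℕ) : ∃ μ : Tup n → ℕ, ∀ b b', eA n i b = some b' → μ b' < μ b := by
  by_cases h0 : i = 0
  · subst h0
    refine ⟨fun b => xc b 1 + xc b 2, ?_⟩
    rintro ⟨f, g⟩ b' h
    simp only [eA, if_true] at h
    split_ifs at h with h1 h2 h3
    · cases h
      dsimp only
      rw [xc_setx _ _ _ _ _ (by omega) (by omega), xc_setx _ _ _ _ _ (by omega) (by omega)]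
      simp only [xc_fst f (setx g 1 (xbc (f, g) 1 + 1)) g]
      simp
      omega
    · cases h
      dsimp only
      rw [xc_setx _ _ _ _ _ (by omega) (by omega), xc_setx _ _ _ _ _ (by omega) (by omega)]
      simp only [xc_fst f (setx g 2 (xbc (f, g) 2 + 1)) g]
      simp
      omega
  by_cases hn : i = n
  · subst hn
    refine ⟨fun b => xbc b i, ?_⟩
    rintro ⟨f, g⟩ b' h
    simp only [eA, if_true, h0, if_false] at h
    split_ifs at h with h1
    cases h
    dsimp only
    rw [xbc_setx _ _ _ _ _ (by omega) (by omega)]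
    simp
    omega
  by_cases hi : i < n
  · exact ⟨fun b => xc b (i+1) + xbc b i, eA_meas_mid i (by omega) hi⟩
  · refine ⟨fun _ => 0, ?_⟩
    intro b b' h
    simp [eA, h0, hn, hi] at h

lemma eps_pos (i : ℕ) (b : Tup n) (h : eA n i b ≠ none) : 0 < epsA n i b := by
  obtain ⟨μ, hμ⟩ := eA_measure (n := n) i
  have hb : BddAbove {m | eAIter n i m b ≠ none} :=
    ⟨μ b, fun m hm => iter_bound (eA n i) μ hμ m b hm⟩
  have : 1 ∈ {m | eAIter n i m b ≠ none} := by
    simpa [eAIter] using h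
  exact le_csSup hb this

lemma fA_uvec (v i : ℕ) (hn : 2 ≤ n) (hi : i ≠ 1) (hin : i ≤ n) :
    fA n i (uvec n v) = none := by
  have hx : ∀ j, 2 ≤ j → xc (uvec n v) j = 0 := by
    intro j hj
    simp [xc, uvec]; omega
  have hxb : ∀ j, xbc (uvec n v) j = 0 := by
    intro j; simp [xbc, uvec]
  by_cases h0 : i = 0
  · subst h0; simp [fA, hxb]
  · simp [fA, h0, hxb, hx n hn, hx i (by omega)]

lemma phi_uvec (v i : ℕ) (hn : 2 ≤ n) (hi : i ≠ 1) (hin : i ≤ n) :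
    phiA n i (uvec n v) = 0 := phi_zero _ _ (fA_uvec v i hn hi hin)

lemma fTen_uvec (v i : ℕ) (hn : 2 ≤ n) (hi : i ≠ 1) (hin : i ≤ n) (b : Tup n) :
    fTenA n i (uvec n v, b) = (fA n i b).map (fun c => (uvec n v, c)) := by
  simp [fTenA, phi_uvec v i hn hi hin]

lemma eTen_uvec (v i : ℕ) (hn : 2 ≤ n) (hi : i ≠ 1) (hin : i ≤ n) (b b' : Tup n)
    (h : eA n i b = some b') :
    eTenA n i (uvec n v, b) = some (uvec n v, b') := by
  have := eps_pos i b (by simp [h])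
  have h2 : ¬ (epsA n i b = 0) := by omega
  simp [eTenA, phi_uvec v i hn hi hin, h, h2]

lemma eTen_none (i : ℕ) (b1 b2 : Tup n) (h : eTenA n i (b1, b2) = none) :
    eA n i b1 = none ∧ epsA n i b2 ≤ phiA n i b1 := by
  unfold eTenA at h
  split_ifs at h with h1
  · exact ⟨by simpa using h, h1⟩
  · have h2 : eA n i b2 = none := by simpa using h
    have := eps_zero i b2 h2
    simp only at h1
    omega

lemma xc_at (b : Tup n) (t : Fin n) : xc b (t + 1) = b.1 t := by
  simp [xc]

lemma xbc_at (b : Tup n) (t : Fin n) : xbc b (t + 1) = b.2 t := by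
  simp [xbc]

lemma eA_none_bar (i : ℕ) (b : Tup n) (h1 : 1 ≤ i) (h2 : i ≤ n) (h : eA n i b = none) :
    xbc b i = 0 ∧ (i < n → xc b (i+1) ≤ xbc b (i+1)) := by
  have h0 : i ≠ 0 := by omega
  by_cases hn : i = n
  · subst hn
    simp [eA, h0] at h
    exact ⟨by omega, fun h => absurd h (lt_irrefl _)⟩
  · have hi : i < n := by omega
    simp only [eA, h0, hn, hi, if_true, if_false] at h
    split_ifs at h
    exact ⟨by omega, fun _ => by omega⟩

/-- all `e_i` with `r ≤ i ≤ n` vanish. -/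
lemma eA_none_all (r : ℕ) (hr : 1 ≤ r) (b : Tup n)
    (h : ∀ i, r ≤ i → i ≤ n → eA n i b = none) :
    (∀ j, r ≤ j → j ≤ n → xbc b j = 0) ∧ (∀ j, r < j → j ≤ n → xc b j = 0) := by
  have h1 : ∀ j, r ≤ j → j ≤ n → xbc b j = 0 := fun j h1 h2 =>
    (eA_none_bar j b (by omega) h2 (h j h1 h2)).1
  refine ⟨h1, fun j h2 h3 => ?_⟩
  obtain ⟨i, rfl⟩ : ∃ i, j = i + 1 := ⟨j - 1, by omega⟩
  have := (eA_none_bar i b (by omega) (by omega) (h i (by omega) (by omega))).2 (by omega)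
  have := h1 (i+1) (by omega) (by omega)
  omega

lemma tsum_triple (hn : 2 ≤ n) (a c d : ℕ) : tsum (tripleVec n a c d) = a + c + d := by
  obtain ⟨m, rfl⟩ : ∃ m, n = m + 2 := ⟨n - 2, by omega⟩
  simp [tsum, tripleVec, Fin.sum_univ_succ]
  omega

lemma tsum_uvec (hn : 2 ≤ n) (a : ℕ) : tsum (uvec n a) = a := by
  obtain ⟨m, rfl⟩ : ∃ m, n = m + 2 := ⟨n - 2, by omega⟩
  simp [tsum, uvec]

lemma eq_uvec (hn : 2 ≤ n) (b : Tup n) (h1 : ∀ j, 1 ≤ j → j ≤ n → xbc b j = 0)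
    (h2 : ∀ j, 1 < j → j ≤ n → xc b j = 0) : b = uvec n (tsum b) := by
  have : ∃ v, b = uvec n v := by
    refine ⟨xc b 1, Prod.ext ?_ ?_⟩
    · funext t
      rw [← xc_at b t]
      simp only [uvec]
      split_ifs with h
      · rw [h]
      · exact h2 _ (by omega) (by omega)
    · funext t
      rw [← xbc_at b t]
      exact h1 _ (by omega) (by omega)
  obtain ⟨v, rfl⟩ := this
  rw [tsum_uvec hn]

lemma eq_triple (b : Tup n) (h1 : ∀ j, 2 ≤ j → j ≤ n → xbc b j = 0)
    (h2 : ∀ j, 2 < j → j ≤ n → xc b j = 0) :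
    b = tripleVec n (xc b 1) (xc b 2) (xbc b 1) := by
  refine Prod.ext ?_ ?_
  · funext t
    rw [← xc_at b t]
    simp only [tripleVec]
    split_ifs with h h'
    · rw [h]
    · rw [h']
    · exact h2 _ (by omega) (by omega)
  · funext t
    rw [← xbc_at b t]
    simp only [tripleVec]
    split_ifs with h
    · rw [h]
    · exact h1 _ (by omega) (by omega)

lemma sum_setx (f : Fin n → ℕ) (j v : ℕ) (h1 : 1 ≤ j) (h2 : j ≤ n) :
    (∑ t, setx f j v t) + f ⟨j - 1, by omega⟩ = (∑ t, f t) + v := by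
  have : setx f j v = Function.update f ⟨j - 1, by omega⟩ v := by
    funext t
    simp only [setx, Function.update_apply, Fin.ext_iff]
    congr 1
    apply propext; omega
  rw [this, Finset.sum_update_of_mem (Finset.mem_univ _)]
  have := Finset.sum_eq_sum_sdiff_singleton_add (Finset.mem_univ (⟨j - 1, by omega⟩ : Fin n)) f
  omega

lemma sum_setx1 (f g : Fin n → ℕ) (j v : ℕ) (h1 : 1 ≤ j) (h2 : j ≤ n) :
    (∑ t, setx f j v t) + xc (f, g) j = (∑ t, f t) + v := by
  have h : j - 1 < n := by omega
  rw [← sum_setx f j v h1 h2]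
  simp [xc, h]

lemma sum_setx2 (f g : Fin n → ℕ) (j v : ℕ) (h1 : 1 ≤ j) (h2 : j ≤ n) :
    (∑ t, setx g j v t) + xbc (f, g) j = (∑ t, g t) + v := by
  have h : j - 1 < n := by omega
  rw [← sum_setx g j v h1 h2]
  simp [xbc, h]

lemma tsum_eq (f g : Fin n → ℕ) : tsum (f, g) = (∑ t, f t) + ∑ t, g t := by
  simp [tsum, Finset.sum_add_distrib]

/-- `f_0` in the relevant region. -/
lemma f0_none (hn : 2 ≤ n) (b : Tup n) (h : xbc b 2 ≤ xc b 2) (h0 : xbc b 1 = 0) :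
    fA n 0 b = none := by
  have : 1 < n := hn
  simp [fA, h, h0]

lemma f0_some (hn : 2 ≤ n) (b : Tup n) (h : xbc b 2 ≤ xc b 2) (h0 : 0 < xbc b 1) :
    ∃ b', fA n 0 b = some b' ∧ tsum b' = tsum b ∧ xbc b' 2 ≤ xc b' 2 ∧
      xbc b' 1 + 1 = xbc b 1 := by
  have h1 : 1 < n := hn
  obtain ⟨f, g⟩ := b
  refine ⟨(setx f 2 (xc (f, g) 2 + 1), setx g 1 (xbc (f, g) 1 - 1)), ?_, ?_, ?_, ?_⟩
  · simp [fA, h, h0, h1]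
  · have a1 := sum_setx1 f g 2 (xc (f, g) 2 + 1) (by omega) (by omega)
    have a2 := sum_setx2 f g 1 (xbc (f, g) 1 - 1) (by omega) (by omega)
    rw [tsum_eq, tsum_eq]
    omega
  · rw [xc_setx _ _ _ _ _ (by omega) (by omega), xbc_setx _ _ _ _ _ (by omega) (by omega),
      xbc_snd (setx f 2 _) f g 2]
    simp only [if_true]
    rw [if_neg (by omega)]
    omega
  · rw [xbc_setx _ _ _ _ _ (by omega) (by omega)]
    simp; omega

lemma f2_none (b : Tup n) (hn : 2 ≤ n) (h : 2 < n → xbc b 3 ≤ xc b 3) (h0 : xc b 2 = 0) :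
    fA n 2 b = none := by
  by_cases h2 : 2 = n
  · subst h2; simp [fA, h0]
  · have h3 : 2 < n := by omega
    simp [fA, h0, h h3, h2]

lemma f2_some (b : Tup n) (hn : 2 ≤ n) (h : 2 < n → xbc b 3 ≤ xc b 3) (h0 : 0 < xc b 2) :
    ∃ b', fA n 2 b = some b' ∧ tsum b' = tsum b ∧ (2 < n → xbc b' 3 ≤ xc b' 3) ∧
      xc b' 2 + 1 = xc b 2 := by
  obtain ⟨f, g⟩ := b
  by_cases h2 : 2 = n
  · refine ⟨(setx f 2 (xc (f, g) 2 - 1), setx g 2 (xbc (f, g) 2 + 1)), ?_, ?_, ?_, ?_⟩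
    · subst h2; simp [fA, h0]
    · have a1 := sum_setx1 f g 2 (xc (f, g) 2 - 1) (by omega) (by omega)
      have a2 := sum_setx2 f g 2 (xbc (f, g) 2 + 1) (by omega) (by omega)
      rw [tsum_eq, tsum_eq]
      omega
    · intro h; omega
    · rw [xc_setx _ _ _ _ _ (by omega) (by omega)]
      simp; omega
  · have h3 : 2 < n := by omega
    refine ⟨(setx (setx f 2 (xc (f, g) 2 - 1)) 3 (xc (f, g) 3 + 1), g), ?_, ?_, ?_, ?_⟩
    · simp [fA, h0, h h3, h2, h3]
    · have a1 := sum_setx1 f g 2 (xc (f, g) 2 - 1) (by omega) (by omega)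
      have a2 := sum_setx1 (setx f 2 (xc (f, g) 2 - 1)) g 3 (xc (f, g) 3 + 1) (by omega) (by omega)
      rw [xc_setx _ _ _ _ _ (by omega) (by omega)] at a2
      rw [if_neg (by omega)] at a2
      rw [tsum_eq, tsum_eq]
      omega
    · intro _
      rw [xc_setx _ _ _ _ _ (by omega) (by omega), xbc_snd _ f g]
      have := h h3
      simp; omega
    · rw [xc_setx _ _ _ _ _ (by omega) (by omega), xc_setx _ _ _ _ _ (by omega) (by omega)]
      simp; omega

lemma step_f {l k : ℕ} (hn : 2 ≤ n) {ι : Tup n × Tup n → Tup n × Tup n} (hι : IsIsoA n l k ι)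
    (i : ℕ) (hi : i ≠ 1) (hin : i ≤ n) (b b' : Tup n) (hb : tsum b = k)
    (h : ι (uvec n l, b) = (uvec n k, b')) :
    (fA n i b).map (fun c => ι (uvec n l, c)) = (fA n i b').map (fun c => (uvec n k, c)) := by
  have := (hι.2 (uvec n l, b) ⟨tsum_uvec hn l, hb⟩ i hin).2
  rw [h, fTen_uvec _ _ hn hi hin, fTen_uvec _ _ hn hi hin, Option.map_map] at this
  exact this

lemma match_gen {l k : ℕ} (hn : 2 ≤ n) {ι : Tup n × Tup n → Tup n × Tup n}
    (hι : IsIsoA n l k ι) (i : ℕ) (hi : i ≠ 1) (hin : i ≤ n) (P : Tup n → Prop) (q : Tup n → ℕ)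
    (hnone : ∀ b, P b → q b = 0 → fA n i b = none)
    (hsome : ∀ b, P b → 0 < q b → ∃ b', fA n i b = some b' ∧ tsum b' = tsum b ∧ P b' ∧
      q b' + 1 = q b) (m : ℕ) :
    ∀ b b', q b = m → P b → P b' → tsum b = k → ι (uvec n l, b) = (uvec n k, b') →
      q b' = m := by
  induction m with
  | zero =>
    intro b b' hq hP hP' hb h
    have := step_f hn hι i hi hin b b' hb h
    rw [hnone b hP hq] at this
    by_contra h0
    obtain ⟨c, hc, -⟩ := hsome b' hP' (by omega)
    rw [hc] at this
    simp at this
  | succ m ih =>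
    intro b b' hq hP hP' hb h
    have h1 := step_f hn hι i hi hin b b' hb h
    obtain ⟨c, hc, hc1, hc2, hc3⟩ := hsome b hP (by omega)
    rw [hc] at h1
    have h0 : 0 < q b' := by
      by_contra h0
      rw [hnone b' hP' (by omega)] at h1
      simp at h1
    obtain ⟨c', hd, hd1, hd2, hd3⟩ := hsome b' hP' h0
    rw [hd] at h1
    have := ih c c' (by omega) hc2 hd2 (by omega) (by simpa using h1)
    omega

lemma xc_triple1 (hn : 2 ≤ n) (a c d : ℕ) : xc (tripleVec n a c d) 1 = a := by
  have : 0 < n := by omega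
  simp [xc, tripleVec, this]
lemma xc_triple2 (hn : 2 ≤ n) (a c d : ℕ) : xc (tripleVec n a c d) 2 = c := by
  have : 1 < n := by omega
  simp [xc, tripleVec, this]
lemma xc_triple3 (a c d j : ℕ) (hj : 2 < j) : xc (tripleVec n a c d) j = 0 := by
  have h1 : j - 1 ≠ 0 := by omega
  have h2 : j - 1 ≠ 1 := by omega
  simp only [xc, tripleVec, h1, h2, if_false]
  split_ifs <;> rfl
lemma xbc_triple1 (hn : 2 ≤ n) (a c d : ℕ) : xbc (tripleVec n a c d) 1 = d := by
  have : 0 < n := by omega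
  simp [xbc, tripleVec, this]
lemma xbc_triple2 (a c d j : ℕ) (hj : 1 < j) : xbc (tripleVec n a c d) j = 0 := by
  simp [xbc, tripleVec]; omega

lemma eA_uvec (v i : ℕ) (h1 : 1 ≤ i) : eA n i (uvec n v) = none := by
  have hx : ∀ j, 2 ≤ j → xc (uvec n v) j = 0 := by
    intro j hj
    simp [xc, uvec]; omega
  have hxb : ∀ j, xbc (uvec n v) j = 0 := by
    intro j; simp [xbc, uvec]
  have h2 := hx (i+1) (by omega)
  have h0 : i ≠ 0 := by omega
  simp [eA, hxb, h2, h0]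

/-- Upper bound of `ε_1`, lower bound of `φ_1`: the tensor is highest. -/
lemma eA_triple_none (hn : 2 ≤ n) (a c d i : ℕ) (h : 2 ≤ i) :
    eA n i (tripleVec n a c d) = none := by
  have h0 : i ≠ 0 := by omega
  have h1 := xc_triple3 (n := n) a c d (i+1) (by omega)
  have h2 := xbc_triple2 (n := n) a c d i (by omega)
  have h3 := xbc_triple2 (n := n) a c d n (by omega)
  simp [eA, h0, h1, h2, h3]

lemma eps1_triple (hn : 2 ≤ n) (a c d : ℕ) : epsA n 1 (tripleVec n a c d) ≤ c + d := by
  apply csSup_le ⟨0, by simp [eAIter]⟩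
  intro m hm
  have := iter_bound (eA n 1) _ (eA_meas_mid 1 le_rfl (by omega)) m _ hm
  rwa [xc_triple2 hn, xbc_triple1 hn] at this

lemma fIter_uvec (hn : 2 ≤ n) (m : ℕ) : ∀ a c,
    (fun o => Option.bind o (fA n 1))^[m] (some (tripleVec n (a + m) c 0)) =
      some (tripleVec n a (c + m) 0) := by
  induction m with
  | zero => intro a c; rfl
  | succ m ih =>
    intro a c
    rw [Function.iterate_succ_apply]
    have : fA n 1 (tripleVec n (a + (m + 1)) c 0) = some (tripleVec n (a + m) (c + 1) 0) := by
      have h1 : (1 : ℕ) ≠ n := by omega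
      have h2 : 1 < n := by omega
      have h3 := xbc_triple2 (n := n) (a + (m+1)) c 0 2 (by omega)
      simp only [fA, h1, h2, xc_triple1 hn, xc_triple2 hn, h3]
      simp
      refine Prod.ext ?_ ?_
      · funext t
        simp only [setx, tripleVec]
        split_ifs <;> omega
      · rfl
    simp only [Option.bind_some, this]
    rw [ih]
    congr 2
    omega

lemma uvec_eq_triple (v : ℕ) : uvec n v = tripleVec n v 0 0 := by
  refine Prod.ext ?_ ?_
  · funext t
    simp [uvec, tripleVec]
  · funext t
    simp [uvec, tripleVec]

lemma barvec_eq_triple (v : ℕ) : barvec n v = tripleVec n 0 0 v := by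
  refine Prod.ext ?_ ?_
  · funext t
    simp [barvec, tripleVec]
  · funext t
    simp [barvec, tripleVec]

lemma phi1_uvec (hn : 2 ≤ n) (v : ℕ) : v ≤ phiA n 1 (uvec n v) := by
  have hb : BddAbove {m | fAIter n 1 m (uvec n v) ≠ none} :=
    ⟨_, fun m hm => iter_bound (fA n 1) _ (fA_meas_mid 1 le_rfl (by omega)) m _ hm⟩
  apply le_csSup hb
  have := fIter_uvec hn v 0 0
  rw [Nat.zero_add] at this
  simp only [Set.mem_ofPred_eq, fAIter]
  rw [uvec_eq_triple, this]
  simp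

lemma eTen_highest (hn : 2 ≤ n) (l a c d i : ℕ) (h : c + d ≤ l) (h1 : 1 ≤ i) :
    eTenA n i (uvec n l, tripleVec n a c d) = none := by
  have : epsA n i (tripleVec n a c d) ≤ phiA n i (uvec n l) := by
    by_cases hi : i = 1
    · subst hi
      exact (eps1_triple hn a c d).trans (h.trans (phi1_uvec hn l))
    · rw [eps_zero _ _ (eA_triple_none hn a c d i (by omega))]
      omega
  simp [eTenA, this, eA_uvec l i h1]

lemma iota_highest {l k : ℕ} (hn : 2 ≤ n) (hkl : k ≤ l)
    {ι : Tup n × Tup n → Tup n × Tup n} (hι : IsIsoA n l k ι)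
    (a c d : ℕ) (hsum : a + c + d = k) :
    ι (uvec n l, tripleVec n a c d) = (uvec n k, tripleVec n (l - c - d) c d) := by
  have hmem : (uvec n l, tripleVec n a c d) ∈ BA n l ×ˢ BA n k :=
    ⟨tsum_uvec hn l, by show tsum _ = k; rw [tsum_triple hn, hsum]⟩
  have him := hι.1.mapsTo hmem
  obtain ⟨⟨b1, b2⟩, hq⟩ : ∃ p, ι (uvec n l, tripleVec n a c d) = p := ⟨_, rfl⟩
  rw [hq] at him
  have hb1 : tsum b1 = k := him.1
  have hb2 : tsum b2 = l := him.2
  have he : ∀ i, 1 ≤ i → i ≤ n → eTenA n i (b1, b2) = none := by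
    intro i h1 h2
    have := (hι.2 _ hmem i h2).1
    rw [eTen_highest hn l a c d i (by omega) h1, hq] at this
    simpa using this.symm
  have e1 : b1 = uvec n k := by
    obtain ⟨p, q⟩ := eA_none_all 1 le_rfl b1 (fun i h1 h2 => (eTen_none i b1 b2 (he i h1 h2)).1)
    rw [← hb1]
    exact eq_uvec hn b1 p q
  subst e1
  have e2 : ∀ i, 2 ≤ i → i ≤ n → eA n i b2 = none := by
    intro i h1 h2
    have h3 := (eTen_none i _ b2 (he i (by omega) h2)).2
    rw [phi_uvec k i hn (by omega) h2] at h3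
    by_contra h4
    have := eps_pos i b2 h4
    omega
  obtain ⟨p, q⟩ := eA_none_all 2 (by omega) b2 e2
  have e3 := eq_triple b2 p q
  have hd : xbc b2 1 = d := by
    refine match_gen hn hι 0 (by omega) (by omega) (fun b => xbc b 2 ≤ xc b 2)
      (fun b => xbc b 1) (f0_none hn) (f0_some hn) d (tripleVec n a c d) b2
      (xbc_triple1 hn a c d) ?_ ?_ hmem.2 hq
    · show xbc _ _ ≤ _
      rw [xbc_triple2 a c d 2 (by omega)]; omega
    · show xbc _ _ ≤ _
      rw [p 2 le_rfl hn]; omega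
  have hc : xc b2 2 = c := by
    refine match_gen hn hι 2 (by omega) (by omega) (fun b => 2 < n → xbc b 3 ≤ xc b 3)
      (fun b => xc b 2) (fun b => f2_none b hn) (fun b => f2_some b hn) c (tripleVec n a c d) b2
      (xc_triple2 hn a c d) ?_ ?_ hmem.2 hq
    · intro _
      rw [xbc_triple2 a c d 3 (by omega)]; omega
    · intro _
      rw [p 3 (by omega) (by omega)]; omega
  have ha : xc b2 1 = l - c - d := by
    have := tsum_triple hn (xc b2 1) (xc b2 2) (xbc b2 1)
    rw [← e3] at this
    omega
  rw [ha, hc, hd] at e3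
  rw [hq, e3]

/-- add one barred letter `j` -/
def addW (b : Tup n) (j : ℕ) : Tup n := (b.1, fun t => b.2 t + if (t : ℕ) + 1 = j then 1 else 0)
/-- add one unbarred letter `j` -/
def addV (b : Tup n) (j : ℕ) : Tup n := (fun t => b.1 t + if (t : ℕ) + 1 = j then 1 else 0, b.2)

lemma sum_single (j : ℕ) (h1 : 1 ≤ j) (h2 : j ≤ n) :
    (∑ t : Fin n, if (t : ℕ) + 1 = j then 1 else 0) = 1 := by
  rw [Finset.sum_eq_single (⟨j - 1, by omega⟩ : Fin n)]
  · rw [if_pos]; simp only; omega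
  · intro b _ hb
    rw [if_neg]
    intro h; apply hb; apply Fin.ext; simp only; omega
  · simp

lemma tsum_addW (b : Tup n) (j : ℕ) (h1 : 1 ≤ j) (h2 : j ≤ n) : tsum (addW b j) = tsum b + 1 := by
  obtain ⟨f, g⟩ := b
  rw [addW, tsum_eq, tsum_eq, Finset.sum_add_distrib, sum_single j h1 h2]; ring

lemma tsum_addV (b : Tup n) (j : ℕ) (h1 : 1 ≤ j) (h2 : j ≤ n) : tsum (addV b j) = tsum b + 1 := by
  obtain ⟨f, g⟩ := b
  rw [addV, tsum_eq, tsum_eq, Finset.sum_add_distrib, sum_single j h1 h2]; ring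

lemma xbc_addW (b : Tup n) (j j' : ℕ) (h1 : 1 ≤ j') (h2 : j' ≤ n) :
    xbc (addW b j) j' = xbc b j' + if j' = j then 1 else 0 := by
  have h : j' - 1 < n := by omega
  have h' : j' - 1 + 1 = j' := by omega
  simp [xbc, addW, h, h']

lemma xc_addV (b : Tup n) (j j' : ℕ) (h1 : 1 ≤ j') (h2 : j' ≤ n) :
    xc (addV b j) j' = xc b j' + if j' = j then 1 else 0 := by
  have h : j' - 1 < n := by omega
  have h' : j' - 1 + 1 = j' := by omega
  simp [xc, addV, h, h']

lemma xc_addW (b : Tup n) (j j' : ℕ) : xc (addW b j) j' = xc b j' := rfl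
lemma xbc_addV (b : Tup n) (j j' : ℕ) : xbc (addV b j) j' = xbc b j' := rfl

lemma tup_ext (b b' : Tup n) (h : ∀ j, 1 ≤ j → j ≤ n → xc b j = xc b' j ∧ xbc b j = xbc b' j) :
    b = b' := by
  refine Prod.ext ?_ ?_
  · funext t
    rw [← xc_at, ← xc_at]; exact (h _ (by omega) (by omega)).1
  · funext t
    rw [← xbc_at, ← xbc_at]; exact (h _ (by omega) (by omega)).2

section Chain

variable (a d : ℕ)

lemma chain0 (hn : 2 ≤ n) : eA n 0 (tripleVec n (a+1) 0 d) = some (addW (tripleVec n a 0 d) 2) := by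
  have h2 := xbc_triple2 (n := n) (a+1) 0 d 2 (by omega)
  have h1 : 1 < n := hn
  simp only [eA, h1, xc_triple1 hn, xc_triple2 hn, h2]
  simp
  refine Prod.ext ?_ ?_
  · funext t
    simp only [addW, setx, tripleVec]
    split_ifs <;> omega
  · funext t
    simp only [addW, setx, tripleVec]
    split_ifs <;> omega

lemma chainW (i : ℕ) (h2 : 2 ≤ i) (hi : i < n) :
    eA n i (addW (tripleVec n a 0 d) i) = some (addW (tripleVec n a 0 d) (i+1)) := by
  have e0 : i ≠ 0 := by omega
  have e1 : i ≠ n := by omega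
  have e2 : xc (tripleVec n a 0 d) (i+1) = 0 := xc_triple3 _ _ _ _ (by omega)
  have e3 : xbc (tripleVec n a 0 d) (i+1) = 0 := xbc_triple2 _ _ _ _ (by omega)
  have e4 : xbc (tripleVec n a 0 d) i = 0 := xbc_triple2 _ _ _ _ (by omega)
  have q1 := xc_addW (tripleVec n a 0 d) i (i+1)
  have q2 := xbc_addW (tripleVec n a 0 d) i (i+1) (by omega) (by omega)
  have q3 := xbc_addW (tripleVec n a 0 d) i i (by omega) (by omega)
  rw [e2] at q1
  rw [e3, if_neg (by omega)] at q2
  rw [e4, if_pos rfl] at q3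
  simp only [eA, e0, e1, hi, q1, q2, q3]
  simp
  refine Prod.ext rfl ?_
  funext t
  simp only [addW, setx, tripleVec]
  split_ifs <;> omega

lemma chainN (hn : 2 ≤ n) :
    eA n n (addW (tripleVec n a 0 d) n) = some (addV (tripleVec n a 0 d) n) := by
  have e0 : n ≠ 0 := by omega
  have e2 : xc (tripleVec n a 0 d) n = 0 := by
    by_cases h : n = 2
    · subst h; exact xc_triple2 le_rfl _ _ _
    · exact xc_triple3 _ _ _ _ (by omega)
  have e4 : xbc (tripleVec n a 0 d) n = 0 := xbc_triple2 _ _ _ _ (by omega)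
  have q1 := xc_addW (tripleVec n a 0 d) n n
  have q3 := xbc_addW (tripleVec n a 0 d) n n (by omega) (by omega)
  rw [e2] at q1
  rw [e4, if_pos rfl] at q3
  simp only [eA, e0, q1, q3]
  simp
  refine Prod.ext ?_ ?_
  · funext t
    simp only [addW, addV, setx, tripleVec]
    split_ifs <;> omega
  · funext t
    simp only [addW, addV, setx, tripleVec]
    split_ifs <;> omega

lemma chainV (i : ℕ) (h2 : 2 ≤ i) (hi : i < n) :
    eA n i (addV (tripleVec n a 0 d) (i+1)) = some (addV (tripleVec n a 0 d) i) := by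
  have e0 : i ≠ 0 := by omega
  have e1 : i ≠ n := by omega
  have e2 : xc (tripleVec n a 0 d) (i+1) = 0 := xc_triple3 _ _ _ _ (by omega)
  have e3 : xbc (tripleVec n a 0 d) (i+1) = 0 := xbc_triple2 _ _ _ _ (by omega)
  have e4 : xc (tripleVec n a 0 d) i = 0 := by
    by_cases h : i = 2
    · subst h; exact xc_triple2 (by omega) _ _ _
    · exact xc_triple3 _ _ _ _ (by omega)
  have q1 := xbc_addV (tripleVec n a 0 d) (i+1) (i+1)
  have q2 := xc_addV (tripleVec n a 0 d) (i+1) (i+1) (by omega) (by omega)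
  have q3 := xc_addV (tripleVec n a 0 d) (i+1) i (by omega) (by omega)
  rw [e3] at q1
  rw [e2, if_pos rfl] at q2
  rw [e4, if_neg (by omega)] at q3
  simp only [eA, e0, e1, hi, q1, q2, q3]
  simp
  refine Prod.ext ?_ rfl
  funext t
  simp only [addV, setx, tripleVec]
  split_ifs <;> omega

lemma addV_two : addV (tripleVec n a 0 d) 2 = tripleVec n a 1 d := by
  refine Prod.ext ?_ rfl
  funext t
  simp only [addV, tripleVec]
  split_ifs <;> omega

lemma e0_triple (hn : 2 ≤ n) (c : ℕ) :
    eA n 0 (tripleVec n a (c+1) d) = some (tripleVec n a c (d+1)) := by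
  have h2 := xbc_triple2 (n := n) a (c+1) d 2 (by omega)
  have h1 : 1 < n := hn
  simp only [eA, h1, xc_triple2 hn, xbc_triple1 hn, h2]
  simp
  refine Prod.ext ?_ ?_
  · funext t
    simp only [setx, tripleVec]
    split_ifs <;> omega
  · funext t
    simp only [setx, tripleVec]
    split_ifs <;> omega

end Chain

lemma H_step {l k : ℕ} (hn : 2 ≤ n) {ι : Tup n × Tup n → Tup n × Tup n}
    {H : Tup n × Tup n → ℤ} (hH : IsEnergyA n l k ι H) (i : ℕ) (h2 : 2 ≤ i) (hi : i ≤ n)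
    (b b' : Tup n) (hb : tsum b = k) (h : eA n i b = some b') :
    H (uvec n l, b') = H (uvec n l, b) := by
  have := hH.1 (uvec n l, b) ⟨tsum_uvec hn l, hb⟩ i hi _
    (eTen_uvec l i hn (by omega) hi b b' h)
  rw [this, if_neg (by omega)]; simp

lemma H_step0 {l k : ℕ} (hn : 2 ≤ n) {ι : Tup n × Tup n → Tup n × Tup n}
    {H : Tup n × Tup n → ℤ} (hH : IsEnergyA n l k ι H)
    (b b' c c' : Tup n) (hb : tsum b = k) (h : eA n 0 b = some b')
    (hι : ι (uvec n l, b) = (uvec n k, c)) (hc : eA n 0 c = some c') :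
    H (uvec n l, b') = H (uvec n l, b) - 1 := by
  have := hH.1 (uvec n l, b) ⟨tsum_uvec hn l, hb⟩ 0 (by omega) _
    (eTen_uvec l 0 hn (by omega) (by omega) b b' h)
  have p1 := eps_pos 0 b (by simp [h])
  have p2 := eps_pos 0 c (by simp [hc])
  rw [this, hι]
  simp only [phi_uvec _ 0 hn (by omega) (by omega)]
  rw [if_pos trivial, if_neg (by omega), if_pos ⟨p1, p2⟩]
  ring

lemma H_W {l k : ℕ} (hn : 2 ≤ n) {ι : Tup n × Tup n → Tup n × Tup n}
    {H : Tup n × Tup n → ℤ} (hH : IsEnergyA n l k ι H) (a d : ℕ) (hs : a + d + 1 = k)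
    (j : ℕ) (h2 : 2 ≤ j) (hj : j ≤ n) :
    H (uvec n l, addW (tripleVec n a 0 d) j) = H (uvec n l, addW (tripleVec n a 0 d) 2) := by
  induction j, h2 using Nat.le_induction with
  | base => rfl
  | succ i h2 ih =>
    rw [← ih (by omega)]
    refine H_step hn hH i h2 (by omega) _ _ ?_ (chainW a d i h2 (by omega))
    rw [tsum_addW _ _ (by omega) (by omega), tsum_triple hn]; omega

lemma H_V {l k : ℕ} (hn : 2 ≤ n) {ι : Tup n × Tup n → Tup n × Tup n}
    {H : Tup n × Tup n → ℤ} (hH : IsEnergyA n l k ι H) (a d : ℕ) (hs : a + d + 1 = k)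
    (j : ℕ) (h2 : 2 ≤ j) (hj : j ≤ n) :
    H (uvec n l, addV (tripleVec n a 0 d) 2) = H (uvec n l, addV (tripleVec n a 0 d) j) := by
  induction j, h2 using Nat.le_induction with
  | base => rfl
  | succ i h2 ih =>
    rw [ih (by omega)]
    refine H_step hn hH i h2 (by omega) _ _ ?_ (chainV a d i h2 (by omega))
    rw [tsum_addV _ _ (by omega) (by omega), tsum_triple hn]; omega

lemma H_c {l k : ℕ} (hn : 2 ≤ n) (hkl : k ≤ l) {ι : Tup n × Tup n → Tup n × Tup n}
    (hι : IsIsoA n l k ι) {H : Tup n × Tup n → ℤ} (hH : IsEnergyA n l k ι H)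
    (a c d : ℕ) (hs : a + (c + 1) + d = k) :
    H (uvec n l, tripleVec n a c (d+1)) = H (uvec n l, tripleVec n a (c+1) d) - 1 :=
  H_step0 hn hH _ _ _ _ (by rw [tsum_triple hn]; omega) (e0_triple a d hn c)
    (iota_highest hn hkl hι a (c+1) d hs) (e0_triple _ d hn c)

lemma H_a {l k : ℕ} (hn : 2 ≤ n) (hkl : k ≤ l) {ι : Tup n × Tup n → Tup n × Tup n}
    (hι : IsIsoA n l k ι) {H : Tup n × Tup n → ℤ} (hH : IsEnergyA n l k ι H)
    (a d : ℕ) (hs : a + 1 + d = k) :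
    H (uvec n l, tripleVec n a 1 d) = H (uvec n l, tripleVec n (a+1) 0 d) - 1 := by
  have hl : l - 0 - d = (l - d - 1) + 1 := by omega
  have h1 := iota_highest hn hkl hι (a+1) 0 d (by omega)
  rw [hl] at h1
  have h2 := H_step0 hn hH _ _ _ _ (by rw [tsum_triple hn]; omega) (chain0 a d hn) h1
    (chain0 _ d hn)
  rw [← h2, ← H_W hn hH a d (by omega) n hn le_rfl, ← addV_two,
    H_V hn hH a d (by omega) n hn le_rfl]
  refine H_step hn hH n hn le_rfl _ _ ?_ (chainN a d hn)
  rw [tsum_addW _ _ (by omega) (by omega), tsum_triple hn]; omega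

lemma H_zero {l k : ℕ} (hn : 2 ≤ n) (hkl : k ≤ l) {ι : Tup n × Tup n → Tup n × Tup n}
    (hι : IsIsoA n l k ι) {H : Tup n × Tup n → ℤ} (hH : IsEnergyA n l k ι H) (a : ℕ) :
    ∀ d, a + d = k → H (uvec n l, tripleVec n a 0 d) = 2 * (a : ℤ) := by
  induction a with
  | zero =>
    intro d hd
    obtain rfl : d = k := by omega
    rw [← barvec_eq_triple, hH.2]; simp
  | succ a ih =>
    intro d hd
    have h1 := H_a hn hkl hι hH a d (by omega)
    have h2 := H_c hn hkl hι hH a 0 d (by omega)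
    have h3 := ih (d+1) (by omega)
    push_cast
    simp only [Nat.zero_add] at h2
    linarith

lemma H_all {l k : ℕ} (hn : 2 ≤ n) (hkl : k ≤ l) {ι : Tup n × Tup n → Tup n × Tup n}
    (hι : IsIsoA n l k ι) {H : Tup n × Tup n → ℤ} (hH : IsEnergyA n l k ι H) (a c : ℕ) :
    ∀ d, a + c + d = k → H (uvec n l, tripleVec n a c d) = 2 * (a : ℤ) + c := by
  induction c with
  | zero =>
    intro d hd
    rw [H_zero hn hkl hι hH a d (by omega)]; simp
  | succ c ih =>
    intro d hd
    have h2 := H_c hn hkl hι hH a c d (by omega)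
    have h3 := ih (d+1) (by omega)
    push_cast
    linarith

end Helpers

/-- **Highest elements for `A_{2n-1}^{(2)}`.**  For nonnegative integers with
`x_1 + x_2 + x̄_1 = k`, the isomorphism maps `(l,0,…,0) ⊗ (x_1,x_2,---,x̄_1)` to
`(k,0,…,0) ⊗ (l-x_2-x̄_1, x_2, ---, x̄_1)` and the energy equals `2k - x_2 - 2x̄_1`. -/
theorem highest_A
    (n l k : ℕ) (hn : 2 ≤ n) (hk : 1 ≤ k) (hkl : k ≤ l)
    (ι : Tup n × Tup n → Tup n × Tup n) (hι : IsIsoA n l k ι)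
    (H : Tup n × Tup n → ℤ) (hH : IsEnergyA n l k ι H)
    (a c d : ℕ) (hsum : a + c + d = k) :
    ι (uvec n l, tripleVec n a c d) = (uvec n k, tripleVec n (l - c - d) c d) ∧
    H (uvec n l, tripleVec n a c d) =
      2 * (k : ℤ) - (c : ℤ) - 2 * (d : ℤ) := by
  refine ⟨iota_highest hn hkl hι a c d hsum, ?_⟩
  rw [H_all hn hkl hι hH a c d hsum]
  have : (k : ℤ) = a + c + d := by exact_mod_cast hsum.symm
  rw [this]; ring
end KTT
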